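/- Let Ω be a compact Hausdorff space, X a Banach space with the Dunford-Pettis property of order p, and Y a Banach space with the p-Dunford-Pettis relatively compact property. Then every dominated operator T : C(Ω,X) → Y is p-convergent, i.e., maps weakly p-summable sequences in C(Ω,X) to norm null sequences in Y. -/

import Mathlib

open Filter Topology Set
open scoped ENNReal

noncomputable section

/-- A sequence in a normed space is weakly null. -/
def WeaklyNull {E : Type*} [NormedAddCommGroup E] [NormedSpace ℝ E] (x : ℕ → E) : Prop :=
  ∀ φ : E →L[ℝ] ℝ, Tendsto (fun n => φ (x n)) atTop (𝓝 0)

/-- A bounded set on which every weakly null sequence of functionals converges uniformly. -/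
def DunfordPettisSet {E : Type*} [NormedAddCommGroup E] [NormedSpace ℝ E] (K : Set E) : Prop :=
  Bornology.IsBounded K ∧ ∀ f : ℕ → (E →L[ℝ] ℝ), WeaklyNull f →
    ∀ ε > 0, ∃ N : ℕ, ∀ n ≥ N, ∀ x ∈ K, |f n x| < ε

/-- Weakly `p`-summable sequence; for `p = ∞` this means weakly null. -/
def WeaklyPSummable (p : ℝ≥0∞) {E : Type*} [NormedAddCommGroup E] [NormedSpace ℝ E]
    (x : ℕ → E) : Prop :=
  if p = ∞ then WeaklyNull x else ∀ φ : E →L[ℝ] ℝ, Memℓp (fun n => φ (x n)) p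

def NormNull {E : Type*} [NormedAddCommGroup E] (x : ℕ → E) : Prop :=
  Tendsto (fun n => ‖x n‖) atTop (𝓝 0)

def PRightNull (p : ℝ≥0∞) {E : Type*} [NormedAddCommGroup E] [NormedSpace ℝ E]
    (x : ℕ → E) : Prop :=
  WeaklyPSummable p x ∧ DunfordPettisSet (Set.range x)

def WeaklyPCauchy (p : ℝ≥0∞) {E : Type*} [NormedAddCommGroup E] [NormedSpace ℝ E]
    (x : ℕ → E) : Prop :=
  ∀ k l : ℕ → ℕ, StrictMono k → StrictMono l →
    WeaklyPSummable p (fun n => x (k n) - x (l n))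

def PRightCauchy (p : ℝ≥0∞) {E : Type*} [NormedAddCommGroup E] [NormedSpace ℝ E]
    (x : ℕ → E) : Prop :=
  WeaklyPCauchy p x ∧ DunfordPettisSet (Set.range x)

/-- `p`-Dunford-Pettis relatively compact property. -/
def HasDPrcP (p : ℝ≥0∞) (E : Type*) [NormedAddCommGroup E] [NormedSpace ℝ E] : Prop :=
  ∀ x : ℕ → E, PRightNull p x → NormNull x

/-- A (not necessarily linear) map is Dunford-Pettis `p`-convergent. -/
def DPpConvergent (p : ℝ≥0∞) {E F : Type*} [NormedAddCommGroup E] [NormedSpace ℝ E]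
    [NormedAddCommGroup F] (f : E → F) : Prop :=
  ∀ x : ℕ → E, PRightNull p x → NormNull (fun n => f (x n))

/-- A map is `p`-convergent. -/
def PConvergent (p : ℝ≥0∞) {E F : Type*} [NormedAddCommGroup E] [NormedSpace ℝ E]
    [NormedAddCommGroup F] (f : E → F) : Prop :=
  ∀ x : ℕ → E, WeaklyPSummable p x → NormNull (fun n => f (x n))

/-- The adjoint of a continuous linear operator between normed spaces. -/
def opAdjoint {E F : Type*} [NormedAddCommGroup E] [NormedSpace ℝ E]
    [NormedAddCommGroup F] [NormedSpace ℝ F] (T : E →L[ℝ] F) :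
    (F →L[ℝ] ℝ) →L[ℝ] (E →L[ℝ] ℝ) :=
  (ContinuousLinearMap.compL ℝ E F ℝ).flip T


/-- A set is relatively weakly compact if its closure in the weak topology is compact. -/
def RelWeaklyCompact {E : Type*} [NormedAddCommGroup E] [NormedSpace ℝ E] (S : Set E) : Prop :=
  IsCompact (closure ((toWeakSpace ℝ E) '' S))

/-- A weakly compact operator: the image of the unit ball is relatively weakly compact. -/
def WeaklyCompactOp {E F : Type*} [NormedAddCommGroup E] [NormedSpace ℝ E]
    [NormedAddCommGroup F] [NormedSpace ℝ F] (S : E →L[ℝ] F) : Prop :=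
  RelWeaklyCompact (S '' (Metric.ball (0 : E) 1))

/-- The Dunford-Pettis property of order `p`: every weakly compact operator into any
Banach space is `p`-convergent. -/
def HasDPPp (p : ℝ≥0∞) (E : Type*) [NormedAddCommGroup E] [NormedSpace ℝ E] : Prop :=
  ∀ (Z : Type) (_ : NormedAddCommGroup Z) (_ : NormedSpace ℝ Z) (_ : CompleteSpace Z)
    (S : E →L[ℝ] Z), WeaklyCompactOp S → PConvergent p S

/-- The continuous real-valued map `ω ↦ ‖f ω‖`. -/
def normComp {Ω X : Type*} [TopologicalSpace Ω] [NormedAddCommGroup X]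
    (f : C(Ω, X)) : C(Ω, ℝ) :=
  ContinuousMap.mk (fun ω => ‖f ω‖) (f.continuous.norm)

/-- A dominated operator on `C(Ω,X)`. -/
def Dominated {Ω X Y : Type*} [TopologicalSpace Ω] [CompactSpace Ω]
    [NormedAddCommGroup X] [NormedSpace ℝ X] [NormedAddCommGroup Y] [NormedSpace ℝ Y]
    (T : C(Ω, X) →L[ℝ] Y) : Prop :=
  ∃ L : C(Ω, ℝ) →L[ℝ] ℝ, (∀ g : C(Ω, ℝ), (∀ ω, 0 ≤ g ω) → 0 ≤ L g) ∧
    ∀ f : C(Ω, X), ‖T f‖ ≤ L (normComp f)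

theorem exists_functional_of_abs_sum_le {E ι : Type*} [NormedAddCommGroup E] [NormedSpace ℝ E]
    (v : ι → E) (a : ι → ℝ)
    (h : ∀ (s : Finset ι) (c : ι → ℝ), |∑ i ∈ s, c i * a i| ≤ ‖∑ i ∈ s, c i • v i‖) :
    ∃ ℓ : E →L[ℝ] ℝ, ‖ℓ‖ ≤ 1 ∧ ∀ i, ℓ (v i) = a i := by
  classical
  let f : (ι →₀ ℝ) →ₗ[ℝ] ℝ := Finsupp.linearCombination ℝ a
  let g : (ι →₀ ℝ) →ₗ[ℝ] E := Finsupp.linearCombination ℝ v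
  have hfg : ∀ x, ‖f x‖ ≤ 1 * ‖g x‖ := by
    intro x
    simpa [f, g, Finsupp.linearCombination_apply, Finsupp.sum, Real.norm_eq_abs] using h x.support x
  obtain ⟨ℓ, hℓ, hn⟩ := exists_extension_norm_eq (LinearMap.range g) (f.compLeftInverse g)
  refine ⟨ℓ, ?_, fun i => ?_⟩
  · rw [hn]
    refine ContinuousLinearMap.opNorm_le_bound _ zero_le_one ?_
    rintro ⟨y, x, rfl⟩
    rw [LinearMap.compLeftInverse_apply_of_bdd f g ⟨1, hfg⟩ x _ rfl]
    exact hfg x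
  · have hi : g (Finsupp.single i 1) = v i := by simp [g]
    rw [← hi, hℓ ⟨_, Finsupp.single i 1, rfl⟩,
      LinearMap.compLeftInverse_apply_of_bdd f g ⟨1, hfg⟩ _ _ rfl]
    simp [f]

theorem WeaklyNull.exists_norm_le {E : Type*} [NormedAddCommGroup E] [NormedSpace ℝ E]
    {x : ℕ → E} (hx : WeaklyNull x) : ∃ C, ∀ n, ‖x n‖ ≤ C := by
  obtain ⟨C, hC⟩ := banach_steinhaus
    (g := fun n => NormedSpace.inclusionInDoubleDual ℝ E (x n)) (fun φ => by
      obtain ⟨C, hC⟩ := (Metric.isBounded_range_of_tendsto _ (hx φ)).exists_norm_le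
      exact ⟨C, fun n => by simpa using hC _ ⟨n, rfl⟩⟩)
  refine ⟨C, fun n => ?_⟩
  have h := hC n
  rwa [show ‖NormedSpace.inclusionInDoubleDual ℝ E (x n)‖ = ‖x n‖ from
    (NormedSpace.inclusionInDoubleDualLi ℝ (E := E)).norm_map (x n)] at h

theorem WeaklyPSummable.weaklyNull {E : Type*} [NormedAddCommGroup E] [NormedSpace ℝ E]
    {p : ℝ≥0∞} (hp : 1 ≤ p) {x : ℕ → E} (hx : WeaklyPSummable p x) : WeaklyNull x := by
  unfold WeaklyPSummable at hx
  split_ifs at hx with h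
  · exact hx
  · intro φ
    have hpos : 0 < p.toReal := ENNReal.toReal_pos (by positivity) h
    have h1 := ((hx φ).summable hpos).tendsto_atTop_zero
    have h2 := h1.rpow_const (p := 1 / p.toReal) (Or.inr (by positivity))
    rw [Real.zero_rpow (by positivity)] at h2
    refine tendsto_zero_iff_norm_tendsto_zero.2 (h2.congr fun n => ?_)
    rw [← Real.rpow_mul (norm_nonneg _), mul_one_div_cancel hpos.ne', Real.rpow_one]

theorem WeaklyNull.map {E F : Type*} [NormedAddCommGroup E] [NormedSpace ℝ E]
    [NormedAddCommGroup F] [NormedSpace ℝ F] {x : ℕ → E} (hx : WeaklyNull x) (S : E →L[ℝ] F) :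
    WeaklyNull (fun n => S (x n)) :=
  fun φ => hx (φ.comp S)

theorem WeaklyPSummable.map {E F : Type*} [NormedAddCommGroup E] [NormedSpace ℝ E]
    [NormedAddCommGroup F] [NormedSpace ℝ F] {p : ℝ≥0∞} {x : ℕ → E}
    (hx : WeaklyPSummable p x) (S : E →L[ℝ] F) : WeaklyPSummable p (fun n => S (x n)) := by
  unfold WeaklyPSummable at hx ⊢
  split_ifs at hx ⊢
  · exact WeaklyNull.map hx S
  · exact fun φ => hx (φ.comp S)

/-- The element of `c₀` given by a null sequence. -/
def nullSeq (a : ℕ → ℝ) (ha : Tendsto a atTop (𝓝 0)) : ZeroAtInftyContinuousMap ℕ ℝ where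
  toFun := a
  continuous_toFun := continuous_of_discreteTopology
  zero_at_infty' := by simpa [cocompact_eq_cofinite, Nat.cofinite_eq_atTop] using ha

theorem ZeroAtInftyContinuousMap.norm_le_of_forall {v : ZeroAtInftyContinuousMap ℕ ℝ} {C : ℝ}
    (hC : 0 ≤ C) (h : ∀ n, |v n| ≤ C) : ‖v‖ ≤ C := by
  rw [← ZeroAtInftyContinuousMap.norm_toBCF_eq_norm]
  exact (BoundedContinuousFunction.norm_le hC).2 h

theorem ZeroAtInftyContinuousMap.abs_apply_le_norm (v : ZeroAtInftyContinuousMap ℕ ℝ) (n : ℕ) :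
    |v n| ≤ ‖v‖ := by
  rw [← ZeroAtInftyContinuousMap.norm_toBCF_eq_norm]
  exact v.toBCF.norm_coe_le_norm n

/-- The unit vectors of `c₀`. -/
def unitSeq (i : ℕ) : ZeroAtInftyContinuousMap ℕ ℝ :=
  nullSeq (fun n => if n = i then 1 else 0)
    (tendsto_const_nhds.congr' (by
      filter_upwards [eventually_gt_atTop i] with n hn
      simp [hn.ne']))

theorem sum_unitSeq_apply (s : Finset ℕ) (c : ℕ → ℝ) (n : ℕ) :
    (∑ i ∈ s, c i • unitSeq i) n = if n ∈ s then c n else 0 := by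
  have h : (∑ i ∈ s, c i • unitSeq i) n = ∑ i ∈ s, (c i • unitSeq i) n := by
    induction s using Finset.cons_induction with
    | empty => simp
    | cons a s ha ih => rw [Finset.sum_cons, Finset.sum_cons, ← ih]; rfl
  rw [h]
  have h' : ∀ i, (c i • unitSeq i) n = if n = i then c i else 0 := by
    intro i
    change c i * (if n = i then (1 : ℝ) else 0) = _
    simp
  simp [h']

theorem hasSum_unitSeq (v : ZeroAtInftyContinuousMap ℕ ℝ) :
    HasSum (fun i => v i • unitSeq i) v := by
  rw [HasSum, SummationFilter.unconditional_filter, Metric.tendsto_nhds]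
  intro ε hε
  have hv : Tendsto v atTop (𝓝 0) := by
    simpa [cocompact_eq_cofinite, Nat.cofinite_eq_atTop] using v.zero_at_infty'
  obtain ⟨N, hN⟩ := Metric.tendsto_atTop.1 hv (ε / 2) (half_pos hε)
  filter_upwards [eventually_ge_atTop (Finset.range N)] with s hs
  rw [dist_eq_norm]
  refine (ZeroAtInftyContinuousMap.norm_le_of_forall (half_pos hε).le fun n => ?_).trans_lt
    (half_lt_self hε)
  change |(∑ i ∈ s, v i • unitSeq i) n - v n| ≤ _
  rw [sum_unitSeq_apply]
  split_ifs with h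
  · simpa using (half_pos hε).le
  · have : N ≤ n := by
      by_contra hlt
      exact h (hs (Finset.mem_range.2 (not_le.1 hlt)))
    simpa [Real.dist_eq] using (hN n this).le

theorem summable_abs_apply_unitSeq (φ : ZeroAtInftyContinuousMap ℕ ℝ →L[ℝ] ℝ) :
    Summable (fun i => |φ (unitSeq i)|) := by
  refine summable_of_sum_le (c := ‖φ‖) (fun _ => abs_nonneg _) fun s => ?_
  have h : ∑ i ∈ s, |φ (unitSeq i)|
      = φ (∑ i ∈ s, (SignType.sign (φ (unitSeq i)) : ℝ) • unitSeq i) := by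
    rw [map_sum]
    refine Finset.sum_congr rfl fun i _ => ?_
    rw [map_smul, smul_eq_mul, sign_mul_self]
  rw [h]
  refine (le_abs_self _).trans ((φ.le_opNorm _).trans ?_)
  refine mul_le_of_le_one_right (norm_nonneg _)
    (ZeroAtInftyContinuousMap.norm_le_of_forall zero_le_one fun n => ?_)
  rw [sum_unitSeq_apply]
  split_ifs
  · rcases lt_trichotomy (φ (unitSeq n)) 0 with h | h | h <;> simp [h]
  · simp

section NullOperator

variable {X : Type*} [NormedAddCommGroup X] [NormedSpace ℝ X]

/-- The operator `X → c₀` given by a weakly null sequence of functionals. -/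
def nullOperator (f : ℕ → (X →L[ℝ] ℝ)) (hf : WeaklyNull f) :
    X →L[ℝ] ZeroAtInftyContinuousMap ℕ ℝ :=
  LinearMap.mkContinuous
    { toFun := fun x => nullSeq (fun n => f n x)
        (hf (NormedSpace.inclusionInDoubleDual ℝ X x))
      map_add' := fun x y => by
        ext n
        exact (f n).map_add x y
      map_smul' := fun c x => by
        ext n
        exact (f n).map_smul c x }
    (max hf.exists_norm_le.choose 0) (fun x => by
      refine ZeroAtInftyContinuousMap.norm_le_of_forall (by positivity) fun n => ?_
      refine ((f n).le_opNorm x).trans ?_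
      gcongr
      exact (hf.exists_norm_le.choose_spec n).trans (le_max_left _ _))

theorem nullOperator_apply (f : ℕ → (X →L[ℝ] ℝ)) (hf : WeaklyNull f) (x : X) (n : ℕ) :
    nullOperator f hf x n = f n x := rfl

theorem apply_nullSeq_bidual (f : ℕ → (X →L[ℝ] ℝ)) (hf : WeaklyNull f)
    (ξ : (X →L[ℝ] ℝ) →L[ℝ] ℝ) (φ : ZeroAtInftyContinuousMap ℕ ℝ →L[ℝ] ℝ) :
    φ (nullSeq (fun n => ξ (f n)) (hf ξ)) = ξ (φ.comp (nullOperator f hf)) := by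
  obtain ⟨C, hC⟩ := hf.exists_norm_le
  have hs : Summable (fun i => φ (unitSeq i) • f i) := by
    refine Summable.of_norm_bounded ((summable_abs_apply_unitSeq φ).mul_right C) fun i => ?_
    rw [norm_smul, Real.norm_eq_abs]
    gcongr
    exact hC i
  have hψ : ∑' i, φ (unitSeq i) • f i = φ.comp (nullOperator f hf) := by
    ext x
    have h1 := hs.hasSum.mapL (NormedSpace.inclusionInDoubleDual ℝ X x)
    have h2 := (hasSum_unitSeq (nullOperator f hf x)).mapL φ
    refine h1.unique ?_
    convert! h2 using 2 with i
    simp [nullOperator_apply, mul_comm]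
  have h3 := hs.hasSum.mapL ξ
  rw [hψ] at h3
  have h4 := (hasSum_unitSeq (nullSeq (fun n => ξ (f n)) (hf ξ))).mapL φ
  refine h4.unique ?_
  convert! h3 using 2 with i
  rw [map_smul, map_smul, smul_eq_mul, smul_eq_mul, mul_comm]
  rfl

theorem weaklyCompactOp_nullOperator (f : ℕ → (X →L[ℝ] ℝ)) (hf : WeaklyNull f) :
    WeaklyCompactOp (nullOperator f hf) := by
  let R : WeakDual ℝ (X →L[ℝ] ℝ) → WeakSpace ℝ (ZeroAtInftyContinuousMap ℕ ℝ) := fun ξ =>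
    toWeakSpace ℝ _ (nullSeq (fun n => WeakDual.toStrongDual ξ (f n))
      (hf (WeakDual.toStrongDual ξ)))
  have hR : Continuous R := by
    refine WeakBilin.continuous_of_continuous_eval _ fun φ => ?_
    have : (fun ξ => (topDualPairing ℝ (ZeroAtInftyContinuousMap ℕ ℝ)).flip (R ξ) φ)
        = fun ξ => ξ (φ.comp (nullOperator f hf)) := by
      funext ξ
      exact apply_nullSeq_bidual f hf (WeakDual.toStrongDual ξ) φ
    rw [this]
    exact WeakDual.eval_continuous _
  have hK := (WeakDual.isCompact_closedBall (𝕜 := ℝ) (E := X →L[ℝ] ℝ) 0 1).image hR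
  refine hK.closure_of_subset ?_
  rintro _ ⟨_, ⟨x, hx, rfl⟩, rfl⟩
  refine ⟨StrongDual.toWeakDual (NormedSpace.inclusionInDoubleDual ℝ X x), ?_, rfl⟩
  simp only [mem_preimage, Metric.mem_closedBall, dist_zero_right]
  refine (NormedSpace.double_dual_bound ℝ X x).trans ?_
  simpa using (mem_ball_zero_iff.1 hx).le

theorem HasDPPp.tendsto_apply {p : ℝ≥0∞} (hX : HasDPPp p X) {x : ℕ → X}
    (hx : WeaklyPSummable p x) (m : ℕ → ℕ) {f : ℕ → (X →L[ℝ] ℝ)} (hf : WeaklyNull f) :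
    Tendsto (fun k => f k (x (m k))) atTop (𝓝 0) := by
  have hS : Tendsto (fun n => ‖nullOperator f hf (x n)‖) atTop (𝓝 0) :=
    hX _ _ _ inferInstance _ (weaklyCompactOp_nullOperator f hf) x hx
  rw [Metric.tendsto_nhds]
  intro ε hε
  obtain ⟨N, hN⟩ := Metric.tendsto_atTop.1 hS ε hε
  have hfin : ∀ᶠ k in atTop, ∀ n ∈ Finset.range N, dist (f k (x n)) 0 < ε :=
    (Filter.eventually_all_finset _).2 fun n _ =>
      Metric.tendsto_nhds.1 (hf (NormedSpace.inclusionInDoubleDual ℝ X (x n))) ε hε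
  filter_upwards [hfin] with k hk
  by_cases h : m k < N
  · exact hk _ (Finset.mem_range.2 h)
  · have h1 := hN _ (not_lt.1 h)
    rw [dist_zero_right, norm_norm] at h1
    rw [dist_zero_right, Real.norm_eq_abs]
    exact (ZeroAtInftyContinuousMap.abs_apply_le_norm (nullOperator f hf (x (m k))) k).trans_lt h1

end NullOperator

section Measure

open MeasureTheory

variable {Ω : Type*} [MeasurableSpace Ω] {μ : Measure Ω} [IsFiniteMeasure μ]

theorem ae_abs_le_norm_of_forall_setIntegral_eq (b : Lp ℝ 1 μ →L[ℝ] ℝ) {h : Ω → ℝ}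
    (hi : Integrable h μ)
    (hb : ∀ s (hs : MeasurableSet s), b (indicatorConstLp 1 hs (measure_ne_top μ s) 1)
      = ∫ ω in s, h ω ∂μ) :
    ∀ᵐ ω ∂μ, |h ω| ≤ ‖b‖ := by
  have key : ∀ s, MeasurableSet s → |∫ ω in s, h ω ∂μ| ≤ ∫ _ in s, ‖b‖ ∂μ := by
    intro s hs
    rw [← hb s hs]
    refine (b.le_opNorm _).trans ?_
    rw [norm_indicatorConstLp one_ne_zero ENNReal.one_ne_top]
    simp [mul_comm]
  have h1 := ae_le_of_forall_setIntegral_le hi (integrable_const ‖b‖)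
    fun s hs _ => (le_abs_self _).trans (key s hs)
  have h2 := ae_le_of_forall_setIntegral_le hi.neg (integrable_const ‖b‖) fun s hs _ => by
    have := (neg_le_abs _).trans (key s hs)
    simpa [integral_neg] using this
  filter_upwards [h1, h2] with ω h1 h2
  exact abs_le'.2 ⟨h1, h2⟩

theorem exists_density_of_dual_L1 (b : Lp ℝ 1 μ →L[ℝ] ℝ) :
    ∃ h : Ω → ℝ, MemLp h 2 μ ∧ ∀ g (hg : MemLp g 2 μ),
      b ((hg.mono_exponent one_le_two).toLp g) = ∫ ω, g ω * h ω ∂μ := by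
  let J : Lp ℝ 2 μ →ₗ[ℝ] Lp ℝ 1 μ :=
    { toFun := fun f => ((Lp.memLp f).mono_exponent one_le_two).toLp f
      map_add' := fun f g => by
        rw [← MemLp.toLp_add]
        exact MemLp.toLp_congr _ _ (Lp.coeFn_add f g)
      map_smul' := fun c f => by
        rw [RingHom.id_apply, ← MemLp.toLp_const_smul]
        exact MemLp.toLp_congr _ _ (Lp.coeFn_smul c f) }
  let J' : Lp ℝ 2 μ →L[ℝ] Lp ℝ 1 μ := J.mkContinuous
    ((μ Set.univ ^ (1 / (1 : ℝ≥0∞).toReal - 1 / (2 : ℝ≥0∞).toReal)).toReal) (fun f => by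
      change ‖((Lp.memLp f).mono_exponent one_le_two).toLp f‖ ≤ _
      rw [Lp.norm_toLp, Lp.norm_def, mul_comm, ← ENNReal.toReal_mul]
      refine ENNReal.toReal_mono (ENNReal.mul_ne_top (Lp.eLpNorm_ne_top f) ?_)
        (eLpNorm_le_eLpNorm_mul_rpow_measure_univ one_le_two (Lp.aestronglyMeasurable f))
      exact ENNReal.rpow_ne_top_of_nonneg (by norm_num) (measure_ne_top μ _))
  let v : Lp ℝ 2 μ := (InnerProductSpace.toDual ℝ (Lp ℝ 2 μ)).symm (b.comp J')
  refine ⟨v, Lp.memLp v, fun g hg => ?_⟩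
  have h1 : b (J' (hg.toLp g)) = inner ℝ v (hg.toLp g) :=
    (InnerProductSpace.toDual_symm_apply (y := b.comp J')).symm
  have h2 : J' (hg.toLp g) = (hg.mono_exponent one_le_two).toLp g :=
    MemLp.toLp_congr ((Lp.memLp _).mono_exponent one_le_two) _ hg.coeFn_toLp
  rw [← h2, h1, L2.inner_def]
  refine integral_congr_ae ?_
  filter_upwards [hg.coeFn_toLp] with ω hω
  simp [hω]

/-- A countable family in the dual of `L¹` has densities which, at almost every point, are the
values of a functional of norm at most one on the dual of `L¹`. -/
theorem exists_density_ae_exists_functional {ι : Type*} [Countable ι]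
    (b : ι → (Lp ℝ 1 μ →L[ℝ] ℝ)) :
    ∃ h : ι → Ω → ℝ, (∀ i, MemLp (h i) 2 μ) ∧
      (∀ i g (hg : MemLp g 2 μ),
        b i ((hg.mono_exponent one_le_two).toLp g) = ∫ ω, g ω * h i ω ∂μ) ∧
      ∀ᵐ ω ∂μ, ∃ ℓ : (Lp ℝ 1 μ →L[ℝ] ℝ) →L[ℝ] ℝ, ‖ℓ‖ ≤ 1 ∧ ∀ i, ℓ (b i) = h i ω := by
  choose h hmem hb using fun i => exists_density_of_dual_L1 (b i)
  refine ⟨h, hmem, hb, ?_⟩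
  have hint : ∀ i, Integrable (h i) μ := fun i => (hmem i).integrable one_le_two
  have key : ∀ (s : Finset ι) (q : s → ℚ), ∀ᵐ ω ∂μ,
      |∑ i, (q i : ℝ) * h i ω| ≤ ‖∑ i, (q i : ℝ) • b i‖ := by
    intro s q
    refine ae_abs_le_norm_of_forall_setIntegral_eq _
      (integrable_finsetSum _ fun i _ => (hint i).const_mul _) fun t ht => ?_
    rw [integral_finsetSum (f := fun (i : s) ω => (q i : ℝ) * h i ω) _
        fun i _ => ((hint i).const_mul _).integrableOn,
      sum_apply]
    refine Finset.sum_congr rfl fun i _ => ?_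
    rw [smul_apply, integral_const_mul, smul_eq_mul]
    congr 1
    have := hb i _ (memLp_indicator_const 2 ht (1 : ℝ) (Or.inr (measure_ne_top μ t)))
    rw [← integral_indicator ht]
    refine Eq.trans this (integral_congr_ae (Eventually.of_forall fun ω => ?_))
    by_cases hω : ω ∈ t <;> simp [hω]
  have hall : ∀ᵐ ω ∂μ, ∀ (s : Finset ι) (q : s → ℚ),
      |∑ i, (q i : ℝ) * h i ω| ≤ ‖∑ i, (q i : ℝ) • b i‖ :=
    ae_all_iff.2 fun s => ae_all_iff.2 fun q => key s q
  filter_upwards [hall] with ω hω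
  refine exists_functional_of_abs_sum_le b (fun i => h i ω) fun s c => ?_
  have hd : DenseRange (fun (q : s → ℚ) (i : s) => (q i : ℝ)) :=
    DenseRange.piMap fun _ => Rat.denseRange_cast
  have hc : ∀ c : s → ℝ, |∑ i, c i * h i ω| ≤ ‖∑ i, c i • b i‖ := fun c =>
    hd.induction_on c (isClosed_le (by fun_prop) (by fun_prop)) (hω s)
  have := hc (fun i => c i)
  rwa [Finset.sum_coe_sort s (fun i => c i * h i ω),
    Finset.sum_coe_sort s (fun i => c i • b i)] at this

theorem exists_measure_of_positive {Ω : Type*} [TopologicalSpace Ω] [CompactSpace Ω] [T2Space Ω]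
    [MeasurableSpace Ω] [BorelSpace Ω] (L : C(Ω, ℝ) →L[ℝ] ℝ)
    (hL : ∀ g : C(Ω, ℝ), (∀ ω, 0 ≤ g ω) → 0 ≤ L g) :
    ∃ μ : Measure Ω, μ.Regular ∧ IsFiniteMeasure μ ∧ ∀ g : C(Ω, ℝ), L g = ∫ ω, g ω ∂μ := by
  let Λ : CompactlySupportedContinuousMap Ω ℝ →ₚ[ℝ] ℝ := PositiveLinearMap.mk₀
    { toFun := fun g => L g.toContinuousMap
      map_add' := fun f g => L.map_add f.toContinuousMap g.toContinuousMap
      map_smul' := fun c g => L.map_smul c g.toContinuousMap }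
    fun g hg => hL g.toContinuousMap hg
  refine ⟨RealRMK.rieszMeasure Λ, inferInstance, inferInstance, fun g => ?_⟩
  exact (RealRMK.integral_rieszMeasure Λ
    (CompactlySupportedContinuousMap.continuousMapEquiv g)).symm

end Measure

section VectorValued

variable {Ω X : Type*} [TopologicalSpace Ω] [NormedAddCommGroup X] [NormedSpace ℝ X]

/-- The function `ω ↦ φ ω • x`. -/
def tensor (φ : C(Ω, ℝ)) (x : X) : C(Ω, X) :=
  ⟨fun ω => φ ω • x, by fun_prop⟩

theorem exists_norm_sub_sum_smul_le [CompactSpace Ω] (F : C(Ω, X)) {ε : ℝ} (hε : 0 < ε) :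
    ∃ (s : Finset X) (φ : X → C(Ω, ℝ)), ∀ ω, ‖F ω - ∑ x ∈ s, φ x ω • x‖ ≤ ε := by
  have hK : IsCompact (range F) := isCompact_range F.continuous
  obtain ⟨t, -, htf, ht⟩ := hK.finite_cover_balls hε
  lift t to Finset X using htf
  let ρ : X → C(Ω, ℝ) := fun x => ⟨fun ω => max 0 (ε - ‖F ω - x‖), by fun_prop⟩
  have hρ : ∀ x ω, 0 ≤ ρ x ω := fun x ω => le_max_left _ _
  have hpos : ∀ ω, 0 < ∑ x ∈ t, ρ x ω := by
    intro ω
    have hω := ht ⟨ω, rfl⟩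
    simp only [mem_iUnion, Metric.mem_ball, dist_eq_norm] at hω
    obtain ⟨x, hx, hlt⟩ := hω
    refine Finset.sum_pos' (fun x _ => hρ x ω) ⟨x, hx, lt_max_of_lt_right (sub_pos.2 hlt)⟩
  refine ⟨t, fun x => ⟨fun ω => ρ x ω / ∑ z ∈ t, ρ z ω,
    (ρ x).continuous.div₀ (by fun_prop) fun ω => (hpos ω).ne'⟩, fun ω => ?_⟩
  have hS := hpos ω
  set S := ∑ z ∈ t, ρ z ω with hSdef
  have hsum : ∑ x ∈ t, ρ x ω / S = 1 := by rw [← Finset.sum_div, div_self hS.ne']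
  have heq : F ω - ∑ x ∈ t, (ρ x ω / S) • x = ∑ x ∈ t, (ρ x ω / S) • (F ω - x) := by
    simp only [smul_sub, Finset.sum_sub_distrib]
    rw [← Finset.sum_smul, hsum, one_smul]
  change ‖F ω - ∑ x ∈ t, (ρ x ω / S) • x‖ ≤ ε
  rw [heq]
  calc ‖∑ x ∈ t, (ρ x ω / S) • (F ω - x)‖ ≤ ∑ x ∈ t, (ρ x ω / S) * ε := by
        refine norm_sum_le_of_le _ fun x _ => ?_
        rw [norm_smul, Real.norm_of_nonneg (div_nonneg (hρ x ω) hS.le)]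
        rcases le_or_gt (ε - ‖F ω - x‖) 0 with h | h
        · have : ρ x ω = 0 := max_eq_left h
          simp [this]
        · gcongr
          · exact div_nonneg (hρ x ω) hS.le
          · linarith
    _ = ε := by rw [← Finset.sum_mul, hsum, one_mul]

end VectorValued

section Dominated

open MeasureTheory

variable {Ω X Y : Type*} [TopologicalSpace Ω] [CompactSpace Ω] [T2Space Ω]
  [MeasurableSpace Ω] [BorelSpace Ω]
  [NormedAddCommGroup X] [NormedSpace ℝ X]
  [NormedAddCommGroup Y] [NormedSpace ℝ Y] [CompleteSpace Y]

/-- A dominated operator `T` extends to an operator-valued map `x ↦ (φ ↦ T (φ • x))` on `L¹`. -/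
theorem exists_L1_extension (T : C(Ω, X) →L[ℝ] Y) (μ : Measure Ω) [μ.Regular] [IsFiniteMeasure μ]
    (hT : ∀ f : C(Ω, X), ‖T f‖ ≤ ∫ ω, ‖f ω‖ ∂μ) :
    ∃ E : X →L[ℝ] (Lp ℝ 1 μ →L[ℝ] Y), ‖E‖ ≤ 1 ∧
      ∀ x φ, E x (ContinuousMap.toLp 1 μ ℝ φ) = T (tensor φ x) := by
  let Ψ : X → (C(Ω, ℝ) →ₗ[ℝ] Y) := fun x =>
    { toFun := fun φ => T (tensor φ x)
      map_add' := fun φ ψ => by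
        rw [← map_add]
        congr 1
        ext ω
        exact add_smul _ _ _
      map_smul' := fun c φ => by
        rw [RingHom.id_apply, ← map_smul]
        congr 1
        ext ω
        exact mul_smul _ _ _ }
  let e : C(Ω, ℝ) →ₗ[ℝ] Lp ℝ 1 μ := (ContinuousMap.toLp 1 μ ℝ).toLinearMap
  have he : DenseRange e := ContinuousMap.toLp_denseRange ℝ μ ℝ ENNReal.one_ne_top
  have hΨ : ∀ x φ, ‖Ψ x φ‖ ≤ ‖x‖ * ‖e φ‖ := by
    intro x φ
    refine (hT (tensor φ x)).trans_eq ?_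
    rw [L1.norm_eq_integral_norm, ← integral_const_mul]
    refine integral_congr_ae ?_
    filter_upwards [ContinuousMap.coeFn_toLp (p := 1) (𝕜 := ℝ) μ φ] with ω hω
    change ‖φ ω • x‖ = ‖x‖ * ‖(ContinuousMap.toLp 1 μ ℝ φ : Lp ℝ 1 μ) ω‖
    rw [hω, norm_smul, mul_comm]
  have hE : ∀ x φ, (Ψ x).extendOfNorm e (e φ) = T (tensor φ x) := fun x φ =>
    LinearMap.extendOfNorm_eq he ⟨_, hΨ x⟩ φ
  let E : X →ₗ[ℝ] (Lp ℝ 1 μ →L[ℝ] Y) :=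
    { toFun := fun x => (Ψ x).extendOfNorm e
      map_add' := fun x z => by
        refine LinearMap.extendOfNorm_unique he _ (hΨ _) _ ?_
        ext φ
        change (Ψ x).extendOfNorm e (e φ) + (Ψ z).extendOfNorm e (e φ) = T (tensor φ (x + z))
        rw [hE, hE, ← map_add]
        congr 1
        ext ω
        exact (smul_add _ _ _).symm
      map_smul' := fun c x => by
        refine LinearMap.extendOfNorm_unique he _ (hΨ _) _ ?_
        ext φ
        change c • (Ψ x).extendOfNorm e (e φ) = T (tensor φ (c • x))
        rw [hE, ← map_smul]
        congr 1
        ext ω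
        exact smul_comm _ _ _ }
  refine ⟨E.mkContinuous 1 fun x => ?_, E.mkContinuous_norm_le zero_le_one _, fun x φ => hE x φ⟩
  rw [one_mul]
  exact LinearMap.opNorm_extendOfNorm_le he (norm_nonneg x) (hΨ x)

/-- If `f k (F k ω) → 0` for every point `ω` and every weakly null sequence `f` of functionals,
then `y k (T (F k)) → 0` for dominated `T` and weakly null `y`. -/
theorem tendsto_apply_of_dominated (T : C(Ω, X) →L[ℝ] Y) (μ : Measure Ω) [μ.Regular]
    [IsFiniteMeasure μ] (hT : ∀ f : C(Ω, X), ‖T f‖ ≤ ∫ ω, ‖f ω‖ ∂μ)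
    (F : ℕ → C(Ω, X)) {C : ℝ} (hF : ∀ k, ‖F k‖ ≤ C)
    (hlim : ∀ ω, ∀ f : ℕ → (X →L[ℝ] ℝ), WeaklyNull f →
      Tendsto (fun k => f k (F k ω)) atTop (𝓝 0))
    {y : ℕ → (Y →L[ℝ] ℝ)} (hy : WeaklyNull y) :
    Tendsto (fun k => y k (T (F k))) atTop (𝓝 0) := by
  obtain ⟨E, hE1, hE⟩ := exists_L1_extension T μ hT
  obtain ⟨D, hD⟩ := hy.exists_norm_le
  have hD0 : 0 ≤ D := (norm_nonneg _).trans (hD 0)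
  have hC0 : 0 ≤ C := (norm_nonneg _).trans (hF 0)
  have hε : ∀ k : ℕ, (0 : ℝ) < 1 / ((k : ℝ) + 1) := fun k => by positivity
  choose s φ hφ using fun k => exists_norm_sub_sum_smul_le (F k) (hε k)
  let G : ℕ → C(Ω, X) := fun k => ∑ x ∈ s k, tensor (φ k x) x
  have hG : ∀ k ω, G k ω = ∑ x ∈ s k, φ k x ω • x := fun k ω => by
    simp [G, tensor]
  have hFG : ∀ k ω, ‖F k ω - G k ω‖ ≤ 1 / ((k : ℝ) + 1) := fun k ω => by
    rw [hG]
    exact hφ k ω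
  have hGC : ∀ k ω, ‖G k ω‖ ≤ C + 1 := fun k ω => by
    have h1 : ‖F k ω‖ ≤ C := ((F k).norm_coe_le_norm ω).trans (hF k)
    have h2 : (1 : ℝ) / ((k : ℝ) + 1) ≤ 1 := by
      rw [div_le_one (by positivity)]
      linarith [(Nat.cast_nonneg k : (0 : ℝ) ≤ k)]
    have h3 := norm_sub_norm_le (G k ω) (F k ω)
    rw [norm_sub_rev] at h3
    linarith [hFG k ω]
  let b : (Σ k, s k) → (Lp ℝ 1 μ →L[ℝ] ℝ) := fun j => (y j.1).comp (E j.2)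
  obtain ⟨h, hmem, hb, hae⟩ := exists_density_ae_exists_functional b
  let I : ℕ → Ω → ℝ := fun k ω => ∑ x : s k, φ k x ω * h ⟨k, x⟩ ω
  have hφ2 : ∀ k x, MemLp (φ k x) 2 μ := fun k x => by
    have := Lp.memLp (ContinuousMap.toLp 2 μ ℝ (φ k x))
    exact this.ae_eq (ContinuousMap.coeFn_toLp μ (φ k x))
  have hint : ∀ k (x : s k), Integrable (fun ω => φ k x ω * h ⟨k, x⟩ ω) μ := fun k x =>
    (hφ2 k x).integrable_mul (hmem ⟨k, x⟩)
  have hI : ∀ k, y k (T (G k)) = ∫ ω, I k ω ∂μ := by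
    intro k
    simp only [G, I]
    rw [integral_finsetSum _ fun x _ => hint k x, map_sum, map_sum, ← Finset.sum_coe_sort]
    refine Finset.sum_congr rfl fun x _ => ?_
    rw [← hb ⟨k, x⟩ _ (hφ2 k x), ← hE]
    change _ = y k (E x _)
    congr 2
  let A : ((Lp ℝ 1 μ →L[ℝ] ℝ) →L[ℝ] ℝ) → ((Y →L[ℝ] ℝ) →L[ℝ] (X →L[ℝ] ℝ)) := fun ℓ =>
    ((ContinuousLinearMap.compL ℝ X (Lp ℝ 1 μ →L[ℝ] ℝ) ℝ ℓ).comp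
      ((ContinuousLinearMap.compL ℝ X (Lp ℝ 1 μ →L[ℝ] Y) (Lp ℝ 1 μ →L[ℝ] ℝ)).flip E)).comp
        (ContinuousLinearMap.compL ℝ (Lp ℝ 1 μ) Y ℝ)
  have hA : ∀ ℓ z x, A ℓ z x = ℓ (z.comp (E x)) := fun _ _ _ => rfl
  have hAle : ∀ ℓ, ‖ℓ‖ ≤ 1 → ∀ k x, |A ℓ (y k) x| ≤ D * ‖x‖ := by
    intro ℓ hℓ k x
    rw [hA]
    calc |ℓ ((y k).comp (E x))| ≤ ‖ℓ‖ * (‖y k‖ * (‖E‖ * ‖x‖)) := by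
          refine (ℓ.le_opNorm _).trans ?_
          gcongr
          refine (ContinuousLinearMap.opNorm_comp_le _ _).trans ?_
          gcongr
          exact E.le_opNorm x
      _ ≤ 1 * (D * (1 * ‖x‖)) := by
          gcongr
          exact hD k
      _ = D * ‖x‖ := by ring
  have hIA : ∀ᵐ ω ∂μ, ∃ ℓ : (Lp ℝ 1 μ →L[ℝ] ℝ) →L[ℝ] ℝ, ‖ℓ‖ ≤ 1 ∧
      ∀ k, I k ω = A ℓ (y k) (G k ω) := by
    filter_upwards [hae] with ω ⟨ℓ, hℓ, hval⟩
    refine ⟨ℓ, hℓ, fun k => ?_⟩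
    rw [hG, map_sum, ← Finset.sum_coe_sort]
    refine Finset.sum_congr rfl fun x _ => ?_
    rw [map_smul, smul_eq_mul, ← hval ⟨k, x⟩, hA]
  have hz : Tendsto (fun k : ℕ => (1 : ℝ) / ((k : ℝ) + 1)) atTop (𝓝 0) :=
    tendsto_one_div_add_atTop_nhds_zero_nat
  have hGlim : Tendsto (fun k => y k (T (G k))) atTop (𝓝 0) := by
    simp only [hI]
    rw [← integral_zero Ω ℝ (μ := μ)]
    refine tendsto_integral_of_dominated_convergence (fun _ => D * (C + 1))
      (fun k => (integrable_finsetSum _ fun x _ => hint k x).aestronglyMeasurable)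
      (integrable_const _) (fun k => ?_) ?_
    · filter_upwards [hIA] with ω ⟨ℓ, hℓ, hIω⟩
      rw [hIω, Real.norm_eq_abs]
      refine (hAle ℓ hℓ k _).trans ?_
      gcongr
      exact hGC k ω
    · filter_upwards [hIA] with ω ⟨ℓ, hℓ, hIω⟩
      have h1 := hlim ω _ (hy.map (A ℓ))
      have h2 : Tendsto (fun k => A ℓ (y k) (F k ω - G k ω)) atTop (𝓝 0) := by
        refine squeeze_zero_norm (fun k => ?_) (by simpa only [mul_zero] using hz.const_mul D)
        refine (hAle ℓ hℓ k _).trans ?_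
        gcongr
        exact hFG k ω
      have h3 := h1.sub h2
      rw [sub_zero] at h3
      refine h3.congr fun k => ?_
      rw [hIω, map_sub, sub_sub_cancel]
  have hdiff : Tendsto (fun k => y k (T (F k - G k))) atTop (𝓝 0) := by
    refine squeeze_zero_norm (fun k => ?_) (by simpa only [mul_zero] using hz.const_mul (D * ‖T‖))
    calc ‖y k (T (F k - G k))‖ ≤ ‖y k‖ * (‖T‖ * ‖F k - G k‖) := by
          refine ((y k).le_opNorm _).trans ?_
          gcongr
          exact T.le_opNorm _
      _ ≤ D * (‖T‖ * (1 / ((k : ℝ) + 1))) := by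
          gcongr
          · exact hD k
          · exact (ContinuousMap.norm_le _ (hε k).le).2 fun ω => hFG k ω
      _ = D * ‖T‖ * (1 / ((k : ℝ) + 1)) := by ring
  have := hdiff.add hGlim
  rw [add_zero] at this
  refine this.congr fun k => ?_
  rw [map_sub, map_sub, sub_add_cancel]

end Dominated

theorem stmt17 {Ω X Y : Type*} [TopologicalSpace Ω] [CompactSpace Ω] [T2Space Ω]
    [NormedAddCommGroup X] [NormedSpace ℝ X] [CompleteSpace X]
    [NormedAddCommGroup Y] [NormedSpace ℝ Y] [CompleteSpace Y]
    (p : ℝ≥0∞) (hp : 1 ≤ p)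
    (hX : HasDPPp p X) (hY : HasDPrcP p Y)
    (T : C(Ω, X) →L[ℝ] Y) (hT : Dominated T) :
    PConvergent p T := by
  intro f hf
  obtain ⟨C, hC⟩ := (hf.weaklyNull hp).exists_norm_le
  refine hY _ ⟨hf.map T, ?_, fun y hy ε hε => ?_⟩
  · refine isBounded_iff_forall_norm_le.2 ⟨‖T‖ * C, ?_⟩
    rintro _ ⟨n, rfl⟩
    exact T.le_opNorm_of_le (hC n)
  · by_contra! hcon
    let _ : MeasurableSpace Ω := borel Ω
    have : BorelSpace Ω := ⟨rfl⟩
    obtain ⟨L, hL, hTL⟩ := hT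
    obtain ⟨μ, hμ, hfin, hint⟩ := exists_measure_of_positive L hL
    have hdom : ∀ g : C(Ω, X), ‖T g‖ ≤ ∫ ω, ‖g ω‖ ∂μ := fun g =>
      (hTL g).trans_eq (hint (normComp g))
    classical
    let m : ℕ → ℕ := fun k => if h : ∃ n, ε ≤ |y k (T (f n))| then h.choose else 0
    have hlim := tendsto_apply_of_dominated T μ hdom (fun k => f (m k)) (fun k => hC (m k))
      (fun ω g hg => hX.tendsto_apply (hf.map (ContinuousMap.evalCLM ℝ ω)) m hg) hy
    obtain ⟨N, hN⟩ := Metric.tendsto_atTop.1 hlim ε hε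
    obtain ⟨k, hk, _, ⟨n, rfl⟩, hn⟩ := hcon N
    have hex : ∃ n, ε ≤ |y k (T (f n))| := ⟨n, hn⟩
    have hmk : m k = hex.choose := dif_pos hex
    have hlt := hN k hk
    rw [Real.dist_eq, sub_zero, hmk] at hlt
    exact absurd hex.choose_spec (not_le.2 hlt)
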